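/- arXiv:1008.2721 — 10 statements merged into one kernel-verified Lean document; each statement's English description precedes it below -/
import Mathlib

section
/- Let x₁,…,x₆ ∈ ℚ. The identity x₁[a,b,c] + x₂[a,c,b] + x₃[b,a,c] + x₄[b,c,a] + x₅[c,a,b] + x₆[c,b,a] = 0 holds for all elements a,b,c of every associative dialgebra over ℚ if and only if x₁ = x₂, x₃ = x₄ and x₅ = x₆; equivalently, every multilinear polynomial identity of degree ≤ 3 satisfied by the PATS is a consequence of P(a,b,c) := [a,b,c] + [a,c,b] ≡ 0. -/
/-- An associative dialgebra over a commutative ring `k`: a `k`-module `D` with two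
bilinear products `l` (left, `⊣`) and `r` (right, `⊢`) satisfying the five dialgebra axioms. -/
structure Dialgebra (k : Type*) (D : Type*) [CommRing k] [AddCommGroup D] [Module k D] where
  l : D →ₗ[k] D →ₗ[k] D
  r : D →ₗ[k] D →ₗ[k] D
  l_assoc : ∀ a b c : D, l (l a b) c = l a (l b c)
  r_assoc : ∀ a b c : D, r (r a b) c = r a (r b c)
  inner_assoc : ∀ a b c : D, l (r a b) c = r a (l b c)
  bar_right : ∀ a b c : D, r (l a b) c = r (r a b) c
  bar_left : ∀ a b c : D, l a (l b c) = l a (r b c)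

/-- The partially alternating ternary sum (PATS):
`[a,b,c] = a⊣b⊣c − a⊣c⊣b − (b⊢a)⊣c + (c⊢a)⊣b + b⊢(c⊢a) − c⊢(b⊢a)`. -/
def Dialgebra.pats {k D : Type*} [CommRing k] [AddCommGroup D] [Module k D]
    (A : Dialgebra k D) (a b c : D) : D :=
  A.l (A.l a b) c - A.l (A.l a c) b - A.l (A.r b a) c + A.l (A.r c a) b
    + A.r b (A.r c a) - A.r c (A.r b a)

namespace Dialgebra

variable {k : Type*} [CommRing k]

theorem pats_swap {D : Type*} [AddCommGroup D] [Module k D] (A : Dialgebra k D) (a b c : D) :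
    A.pats a c b = -A.pats a b c := by
  unfold pats
  abel

/-- The dialgebra on `R × R` arising from the `R`-bimodule map `Prod.fst : R × R → R`:
`p ⊣ q = p * q.1` and `p ⊢ q = p.1 * q`. -/
def ofProd (k R : Type*) [CommRing k] [Ring R] [Algebra k R] : Dialgebra k (R × R) where
  l := LinearMap.mk₂ k (fun p q => (p.1 * q.1, p.2 * q.1))
    (by intros; simp [add_mul]) (by intros; simp) (by intros; simp [mul_add]) (by intros; simp)
  r := LinearMap.mk₂ k (fun p q => (p.1 * q.1, p.1 * q.2))
    (by intros; simp [add_mul]) (by intros; simp) (by intros; simp [mul_add]) (by intros; simp)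
  l_assoc a b c := by simp [mul_assoc]
  r_assoc a b c := by simp [mul_assoc]
  inner_assoc a b c := by simp [mul_assoc]
  bar_right a b c := by simp
  bar_left a b c := by simp

variable {R : Type*} [Ring R] [Algebra k R]

@[simp]
theorem ofProd_l (p q : R × R) : (ofProd k R).l p q = (p.1 * q.1, p.2 * q.1) := rfl

@[simp]
theorem ofProd_r (p q : R × R) : (ofProd k R).r p q = (p.1 * q.1, p.1 * q.2) := rfl

theorem ofProd_pats_center (X Y : R) :
    (ofProd k R).pats (0, 1) (X, 0) (Y, 0) = (0, X * Y - Y * X) := by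
  simp [pats]

theorem ofProd_pats_left (X Y : R) :
    (ofProd k R).pats (X, 0) (0, 1) (Y, 0) = 0 := by
  simp [pats]

theorem ofProd_pats_right (X Y : R) :
    (ofProd k R).pats (X, 0) (Y, 0) (0, 1) = 0 := by
  simp [pats]

end Dialgebra

theorem exists_matrix_not_commute :
    ∃ X Y : Matrix (Fin 2) (Fin 2) ℚ, X * Y - Y * X ≠ 0 := by
  refine ⟨!![0, 1; 0, 0], !![0, 0; 1, 0], fun h => ?_⟩
  have := congrFun (congrFun h 0) 0
  simp at this

/-- for `x₁,…,x₆ ∈ ℚ`, the identity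
`x₁[a,b,c] + x₂[a,c,b] + x₃[b,a,c] + x₄[b,c,a] + x₅[c,a,b] + x₆[c,b,a] = 0`
holds in every associative dialgebra over `ℚ` iff `x₁ = x₂ ∧ x₃ = x₄ ∧ x₅ = x₆`;
i.e. every multilinear identity of degree ≤ 3 of the PATS follows from
`P(a,b,c) = [a,b,c] + [a,c,b] ≡ 0`. -/
theorem degree_three_identities (x₁ x₂ x₃ x₄ x₅ x₆ : ℚ) :
    (∀ (D : Type) [AddCommGroup D] [Module ℚ D] (A : Dialgebra ℚ D) (a b c : D),
        x₁ • A.pats a b c + x₂ • A.pats a c b + x₃ • A.pats b a c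
          + x₄ • A.pats b c a + x₅ • A.pats c a b + x₆ • A.pats c b a = 0)
      ↔ (x₁ = x₂ ∧ x₃ = x₄ ∧ x₅ = x₆) := by
  constructor
  · intro h
    obtain ⟨X, Y, hXY⟩ := exists_matrix_not_commute
    have key (s t : ℚ)
        (e : s • (X * Y - Y * X) + t • (Y * X - X * Y) = 0) : s = t := by
      rw [← neg_sub (X * Y), smul_neg, ← sub_eq_add_neg, ← sub_smul] at e
      exact sub_eq_zero.mp ((smul_eq_zero.mp e).resolve_right hXY)
    let A := Dialgebra.ofProd ℚ (Matrix (Fin 2) (Fin 2) ℚ)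
    have ha := congrArg Prod.snd (h _ A (0, 1) (X, 0) (Y, 0))
    have hb := congrArg Prod.snd (h _ A (X, 0) (0, 1) (Y, 0))
    have hc := congrArg Prod.snd (h _ A (X, 0) (Y, 0) (0, 1))
    simp only [A, Dialgebra.ofProd_pats_center, Dialgebra.ofProd_pats_left,
      Dialgebra.ofProd_pats_right, Prod.snd_add, Prod.smul_snd, Prod.snd_zero, smul_zero,
      add_zero, zero_add] at ha hb hc
    exact ⟨key _ _ ha, key _ _ hb, key _ _ hc⟩
  · rintro ⟨rfl, rfl, rfl⟩ D _ _ A a b c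
    rw [A.pats_swap a b c, A.pats_swap b a c, A.pats_swap c a b]
    module
end

section
/- In every associative dialgebra D over a commutative ring, for all a,b,c,d,e ∈ D the nested PATS expands as [a,[b,c,d],e] = âbcde − âbdce − âcbde + âcdbe + âdbce − âdcbe − âebcd + âebdc + âecbd − âecdb − âedbc + âedcb + eâbcd − eâbdc − eâcbd + eâcdb + eâdbc − eâdcb − bcdâe + bdcâe + cbdâe − cdbâe − dbcâe + dcbâe + bcdeâ − bdceâ − cbdeâ + cdbeâ + dbceâ − dcbeâ − ebcdâ + ebdcâ + ecbdâ − ecdbâ − edbcâ + edcbâ. -/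
section Hats
variable {k D : Type*} [CommRing k] [AddCommGroup D] [Module k D]

/-- Normal form `x̂₁x₂x₃x₄x₅ = x₁ ⊣ x₂ ⊣ x₃ ⊣ x₄ ⊣ x₅` (center in position 1). -/
def Dialgebra.hat1 (A : Dialgebra k D) (x₁ x₂ x₃ x₄ x₅ : D) : D :=
  A.l (A.l (A.l (A.l x₁ x₂) x₃) x₄) x₅

/-- Normal form `x₁x̂₂x₃x₄x₅ = x₁ ⊢ x₂ ⊣ (x₃ ⊣ x₄ ⊣ x₅)` (center in position 2). -/
def Dialgebra.hat2 (A : Dialgebra k D) (x₁ x₂ x₃ x₄ x₅ : D) : D :=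
  A.r x₁ (A.l (A.l (A.l x₂ x₃) x₄) x₅)

/-- Normal form `x₁x₂x̂₃x₄x₅ = (x₁ ⊢ x₂) ⊢ x₃ ⊣ (x₄ ⊣ x₅)` (center in position 3). -/
def Dialgebra.hat3 (A : Dialgebra k D) (x₁ x₂ x₃ x₄ x₅ : D) : D :=
  A.r (A.r x₁ x₂) (A.l (A.l x₃ x₄) x₅)

/-- Normal form `x₁x₂x₃x̂₄x₅ = (x₁ ⊢ x₂ ⊢ x₃) ⊢ x₄ ⊣ x₅` (center in position 4). -/
def Dialgebra.hat4 (A : Dialgebra k D) (x₁ x₂ x₃ x₄ x₅ : D) : D :=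
  A.r (A.r (A.r x₁ x₂) x₃) (A.l x₄ x₅)

/-- Normal form `x₁x₂x₃x₄x̂₅ = x₁ ⊢ x₂ ⊢ x₃ ⊢ x₄ ⊢ x₅` (center in position 5). -/
def Dialgebra.hat5 (A : Dialgebra k D) (x₁ x₂ x₃ x₄ x₅ : D) : D :=
  A.r (A.r (A.r (A.r x₁ x₂) x₃) x₄) x₅

end Hats

section PatsProducts
variable {k D : Type*} [CommRing k] [AddCommGroup D] [Module k D]

/-- Multiplying a PATS from the left by `⊣` gives the alternating sum over its arguments. -/
theorem Dialgebra.l_pats (A : Dialgebra k D) (x b c d : D) :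
    A.l x (A.pats b c d) =
      A.l (A.l (A.l x b) c) d - A.l (A.l (A.l x b) d) c - A.l (A.l (A.l x c) b) d
      + A.l (A.l (A.l x c) d) b + A.l (A.l (A.l x d) b) c - A.l (A.l (A.l x d) c) b := by
  simp only [Dialgebra.pats, map_add, map_sub, A.inner_assoc, ← A.bar_left, ← A.l_assoc]
  abel

/-- Multiplying a PATS from the right by `⊢` gives the alternating sum over its arguments. -/
theorem Dialgebra.r_pats (A : Dialgebra k D) (b c d x : D) :
    A.r (A.pats b c d) x =
      A.r (A.r (A.r b c) d) x - A.r (A.r (A.r b d) c) x - A.r (A.r (A.r c b) d) x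
      + A.r (A.r (A.r c d) b) x + A.r (A.r (A.r d b) c) x - A.r (A.r (A.r d c) b) x := by
  simp only [Dialgebra.pats, map_add, map_sub, LinearMap.add_apply, LinearMap.sub_apply,
    A.bar_right, ← A.r_assoc]
  abel

end PatsProducts

/-- expansion of the nested PATS `[a,[b,c,d],e]` into 36 dialgebra
monomials in normal (hat) form. -/
theorem expansion_a_bcd_e
    (k D : Type*) [CommRing k] [AddCommGroup D] [Module k D]
    (A : Dialgebra k D) (a b c d e : D) :
    A.pats a (A.pats b c d) e =
        A.hat1 a b c d e - A.hat1 a b d c e - A.hat1 a c b d e + A.hat1 a c d b e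
      + A.hat1 a d b c e - A.hat1 a d c b e - A.hat1 a e b c d + A.hat1 a e b d c
      + A.hat1 a e c b d - A.hat1 a e c d b - A.hat1 a e d b c + A.hat1 a e d c b
      + A.hat2 e a b c d - A.hat2 e a b d c - A.hat2 e a c b d + A.hat2 e a c d b
      + A.hat2 e a d b c - A.hat2 e a d c b
      - A.hat4 b c d a e + A.hat4 b d c a e + A.hat4 c b d a e - A.hat4 c d b a e
      - A.hat4 d b c a e + A.hat4 d c b a e
      + A.hat5 b c d e a - A.hat5 b d c e a - A.hat5 c b d e a + A.hat5 c d b e a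
      + A.hat5 d b c e a - A.hat5 d c b e a - A.hat5 e b c d a + A.hat5 e b d c a
      + A.hat5 e c b d a - A.hat5 e c d b a - A.hat5 e d b c a + A.hat5 e d c b a := by
  rw [Dialgebra.pats, A.l_pats, A.l_pats, A.inner_assoc (A.pats b c d), A.inner_assoc e,
    A.l_pats, A.r_pats, A.r_pats, A.r_pats]
  simp only [Dialgebra.hat1, Dialgebra.hat2, Dialgebra.hat4, Dialgebra.hat5,
    map_add, map_sub, LinearMap.add_apply, LinearMap.sub_apply, ← A.r_assoc]
  abel
end

section
/- In every associative dialgebra D over a commutative ring, the PATS satisfies Q(a,b,c,d,e) := [a,[b,c,d],e] + [a,[c,b,d],e] = 0 for all a,b,c,d,e ∈ D. -/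
namespace Dialgebra

variable {k D : Type*} [CommRing k] [AddCommGroup D] [Module k D] (A : Dialgebra k D)

/-- Below the bar of `⊣`, the PATS is skew-symmetric in its first two arguments. -/
theorem l_pats_add_pats_swap (x b c d : D) : A.l x (A.pats b c d + A.pats c b d) = 0 := by
  simp only [pats, map_add, map_sub, A.l_assoc, A.inner_assoc, ← A.bar_left]
  abel

/-- Below the bar of `⊢`, the PATS is skew-symmetric in its first two arguments. -/
theorem r_pats_add_pats_swap (x b c d : D) : A.r (A.pats b c d + A.pats c b d) x = 0 := by
  simp only [pats, map_add, map_sub, LinearMap.add_apply, LinearMap.sub_apply,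
    A.bar_right, A.r_assoc]
  abel

theorem pats_add_middle (a x y e : D) :
    A.pats a x e + A.pats a y e = A.pats a (x + y) e := by
  simp only [pats, map_add, LinearMap.add_apply]
  abel

theorem pats_eq_zero_of_middle {a m e : D} (hl : ∀ x, A.l x m = 0) (hr : ∀ x, A.r m x = 0) :
    A.pats a m e = 0 := by
  simp [pats, hl, hr]

end Dialgebra

/-- the PATS satisfies `Q(a,b,c,d,e) = [a,[b,c,d],e] + [a,[c,b,d],e] = 0`. -/
theorem pats_Q
    (k D : Type*) [CommRing k] [AddCommGroup D] [Module k D]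
    (A : Dialgebra k D) (a b c d e : D) :
    A.pats a (A.pats b c d) e + A.pats a (A.pats c b d) e = 0 := by
  rw [A.pats_add_middle]
  exact A.pats_eq_zero_of_middle (fun x => A.l_pats_add_pats_swap x b c d)
    (fun x => A.r_pats_add_pats_swap x b c d)
end

section
/- In every associative dialgebra D over a commutative ring, the PATS satisfies [a,[b,c,d],e] − [a,[d,b,c],e] = 0 for all a,b,c,d,e ∈ D; that is, the inner triple in the second argument of a nested PATS is invariant under cyclic permutation. -/
/-- Acting on the left product from the right, the PATS is invariant under cyclic permutation. -/
theorem Dialgebra.l_pats_cyclic {k D : Type*} [CommRing k] [AddCommGroup D] [Module k D]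
    (A : Dialgebra k D) (a b c d : D) : A.l a (A.pats b c d) = A.l a (A.pats d b c) := by
  simp only [Dialgebra.pats, map_add, map_sub, A.l_assoc, A.inner_assoc, ← A.bar_left]
  abel

/-- Acting on the right product from the left, the PATS is invariant under cyclic permutation. -/
theorem Dialgebra.r_pats_cyclic {k D : Type*} [CommRing k] [AddCommGroup D] [Module k D]
    (A : Dialgebra k D) (a b c d : D) : A.r (A.pats b c d) a = A.r (A.pats d b c) a := by
  simp only [Dialgebra.pats, map_add, map_sub, LinearMap.add_apply, LinearMap.sub_apply,
    A.bar_right, A.r_assoc]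
  abel

/-- the PATS satisfies `[a,[b,c,d],e] − [a,[d,b,c],e] = 0`: the inner
triple in the second argument of a nested PATS is invariant under cyclic permutation. -/
theorem pats_inner_cyclic
    (k D : Type*) [CommRing k] [AddCommGroup D] [Module k D]
    (A : Dialgebra k D) (a b c d e : D) :
    A.pats a (A.pats b c d) e - A.pats a (A.pats d b c) e = 0 := by
  have key (x y : D)
      (hl : ∀ z, A.l z x = A.l z y) (hr : ∀ z, A.r x z = A.r y z) :
      A.pats a x e = A.pats a y e := by
    simp only [Dialgebra.pats, hl, hr]
  exact sub_eq_zero.2 (key _ _ (fun z => A.l_pats_cyclic z b c d)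
    (fun z => A.r_pats_cyclic z b c d))
end

section
/- Let T be a partially alternating ternary algebra with product (·,·,·). Then every multilinear degree-5 monomial in distinct variables a,b,c,d,e — i.e. any of the three association types ((x₁,x₂,x₃),x₄,x₅), (x₁,(x₂,x₃,x₄),x₅), (x₁,x₂,(x₃,x₄,x₅)) applied to any permutation of a,b,c,d,e — equals ε·m for some sign ε ∈ {1,−1} and some monomial m from the following list of 90 monomials: ((aσ,bσ,cσ),dσ,eσ) with bσ < cσ and dσ < eσ, or (aσ,(bσ,cσ,dσ),eσ) with cσ < dσ, where σ ranges over permutations of {a,b,c,d,e} and < denotes a fixed total order a < b < c < d < e. -/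
/-- A partially alternating ternary algebra (PATA) over a commutative ring `k`:
a `k`-module `T` with a trilinear product satisfying
`P(a,b,c) = (a,b,c) + (a,c,b) ≡ 0` and `Q(a,b,c,d,e) = (a,(b,c,d),e) + (a,(c,b,d),e) ≡ 0`. -/
structure PATA (k : Type*) (T : Type*) [CommRing k] [AddCommGroup T] [Module k T] where
  t : T →ₗ[k] T →ₗ[k] T →ₗ[k] T
  idP : ∀ a b c : T, t a b c + t a c b = 0
  idQ : ∀ a b c d e : T, t a (t b c d) e + t a (t c b d) e = 0

/-- The product is skew in its last two arguments. -/
theorem PATA.t_swap {k T : Type*} [CommRing k] [AddCommGroup T] [Module k T]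
    (A : PATA k T) (a b c : T) : A.t a b c = -A.t a c b :=
  eq_neg_of_add_eq_zero_left (A.idP a b c)

/-- A monomial of the second association type can be straightened, up to sign. -/
theorem PATA.exists_straight_middle {k T : Type*} [CommRing k] [AddCommGroup T] [Module k T]
    (A : PATA k T) (v : Fin 5 → T) (σ : Equiv.Perm (Fin 5)) :
    ∃ (ε : ℤ) (τ : Equiv.Perm (Fin 5)), (ε = 1 ∨ ε = -1) ∧ τ 2 < τ 3 ∧
      A.t (v (σ 0)) (A.t (v (σ 1)) (v (σ 2)) (v (σ 3))) (v (σ 4)) =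
        ε • A.t (v (τ 0)) (A.t (v (τ 1)) (v (τ 2)) (v (τ 3))) (v (τ 4)) := by
  rcases lt_or_gt_of_ne (σ.injective.ne (show (2 : Fin 5) ≠ 3 by decide)) with h | h
  · exact ⟨1, σ, .inl rfl, h, (one_smul _ _).symm⟩
  · refine ⟨-1, σ * Equiv.swap 2 3, .inr rfl, by simpa using h, ?_⟩
    rw [A.t_swap (v (σ 1))]
    simp [Equiv.swap_apply_def]

/-- A monomial of the first association type can be straightened, up to sign. -/
theorem PATA.exists_straight_left {k T : Type*} [CommRing k] [AddCommGroup T] [Module k T]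
    (A : PATA k T) (v : Fin 5 → T) (σ : Equiv.Perm (Fin 5)) :
    ∃ (ε : ℤ) (τ : Equiv.Perm (Fin 5)), (ε = 1 ∨ ε = -1) ∧ τ 1 < τ 2 ∧ τ 3 < τ 4 ∧
      A.t (A.t (v (σ 0)) (v (σ 1)) (v (σ 2))) (v (σ 3)) (v (σ 4)) =
        ε • A.t (A.t (v (τ 0)) (v (τ 1)) (v (τ 2))) (v (τ 3)) (v (τ 4)) := by
  rcases lt_or_gt_of_ne (σ.injective.ne (show (1 : Fin 5) ≠ 2 by decide)) with h | h <;>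
    rcases lt_or_gt_of_ne (σ.injective.ne (show (3 : Fin 5) ≠ 4 by decide)) with h' | h'
  · exact ⟨1, σ, .inl rfl, h, h', (one_smul _ _).symm⟩
  · refine ⟨-1, σ * Equiv.swap 3 4, .inr rfl, by simpa [Equiv.swap_apply_def] using h,
      by simpa using h', ?_⟩
    rw [A.t_swap _ (v (σ 3))]
    simp [Equiv.swap_apply_def]
  · refine ⟨-1, σ * Equiv.swap 1 2, .inr rfl, by simpa using h,
      by simpa [Equiv.swap_apply_def] using h', ?_⟩
    rw [A.t_swap _ (v (σ 1))]
    simp [Equiv.swap_apply_def]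
  · refine ⟨1, σ * (Equiv.swap 1 2 * Equiv.swap 3 4), .inl rfl,
      by simpa [Equiv.swap_apply_def] using h, by simpa [Equiv.swap_apply_def] using h', ?_⟩
    rw [A.t_swap _ (v (σ 3)), A.t_swap _ (v (σ 1))]
    simp [Equiv.swap_apply_def]

/-- in a PATA, every multilinear degree-5 monomial (any of the three
association types applied to any permutation of the variables `v 0,…,v 4`) equals
`ε • m` with `ε ∈ {1,−1}` and `m` one of the 90 straightened monomials
`((aτ,bτ,cτ),dτ,eτ)` with `τ 1 < τ 2`, `τ 3 < τ 4`, or `(aτ,(bτ,cτ,dτ),eτ)` with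
`τ 2 < τ 3`. -/
theorem degree5_monomials
    (k T : Type*) [CommRing k] [AddCommGroup T] [Module k T]
    (A : PATA k T) (v : Fin 5 → T) (σ : Equiv.Perm (Fin 5)) (x : T)
    (hx : x = A.t (A.t (v (σ 0)) (v (σ 1)) (v (σ 2))) (v (σ 3)) (v (σ 4)) ∨
          x = A.t (v (σ 0)) (A.t (v (σ 1)) (v (σ 2)) (v (σ 3))) (v (σ 4)) ∨
          x = A.t (v (σ 0)) (v (σ 1)) (A.t (v (σ 2)) (v (σ 3)) (v (σ 4)))) :
    ∃ (ε : ℤ) (τ : Equiv.Perm (Fin 5)), (ε = 1 ∨ ε = -1) ∧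
      ((τ 1 < τ 2 ∧ τ 3 < τ 4 ∧
          x = ε • A.t (A.t (v (τ 0)) (v (τ 1)) (v (τ 2))) (v (τ 3)) (v (τ 4))) ∨
       (τ 2 < τ 3 ∧
          x = ε • A.t (v (τ 0)) (A.t (v (τ 1)) (v (τ 2)) (v (τ 3))) (v (τ 4)))) := by
  rcases hx with rfl | rfl | rfl
  · obtain ⟨ε, τ, hε, h, h', e⟩ := A.exists_straight_left v σ
    exact ⟨ε, τ, hε, .inl ⟨h, h', e⟩⟩
  · obtain ⟨ε, τ, hε, h, e⟩ := A.exists_straight_middle v σ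
    exact ⟨ε, τ, hε, .inr ⟨h, e⟩⟩
  · obtain ⟨ε, τ, hε, h, e⟩ := A.exists_straight_middle v
      (σ * (Equiv.swap 1 2 * Equiv.swap 2 3 * Equiv.swap 3 4))
    refine ⟨-ε, τ, by simpa [neg_eq_iff_eq_neg, or_comm] using hε, .inr ⟨h, ?_⟩⟩
    rw [A.t_swap, neg_smul, ← e]
    simp [Equiv.swap_apply_def]
end

section
/- Let M be the set of 90 degree-5 monomials ((aσ,bσ,cσ),dσ,eσ) with bσ < cσ, dσ < eσ, and (aσ,(bσ,cσ,dσ),eσ) with cσ < dσ, where σ ranges over permutations of {a,b,c,d,e}. A coefficient vector x ∈ ℚ^M satisfies Σ_{m∈M} x_m · m = 0 under the PATS in every associative dialgebra over ℚ and for all values of a,b,c,d,e if and only if x lies in the ℚ-span of the 40 coefficient vectors of the identities [aσ,[bσ,cσ,dσ],eσ] + [aσ,[cσ,bσ,dσ],eσ] and [aσ,[bσ,cσ,dσ],eσ] − [aσ,[dσ,bσ,cσ],eσ] taken over permutations σ with bσ < cσ < dσ; this span has dimension 40. In particular, every multilinear polynomial identity of degree ≤ 5 satisfied by the PATS is a consequence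 of P ≡ 0 and Q ≡ 0. -/
/-- The index set of the 90 straightened multilinear degree-5 ternary monomials:
type `0` is `((x₀,x₁,x₂),x₃,x₄)` with `τ 1 < τ 2`, `τ 3 < τ 4`;
type `1` is `(x₀,(x₁,x₂,x₃),x₄)` with `τ 2 < τ 3`. -/
def Mon5 : Type :=
  {p : Fin 2 × Equiv.Perm (Fin 5) //
    (p.1 = 0 → p.2 1 < p.2 2 ∧ p.2 3 < p.2 4) ∧ (p.1 = 1 → p.2 2 < p.2 3)}

noncomputable instance : Fintype Mon5 := by
  unfold Mon5
  classical
  infer_instance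

/-- Evaluation of a straightened degree-5 monomial under the PATS. -/
def evalMon5 {D : Type} [AddCommGroup D] [Module ℚ D] (A : Dialgebra ℚ D)
    (v : Fin 5 → D) (m : Mon5) : D :=
  if m.1.1 = 0 then
    A.pats (A.pats (v (m.1.2 0)) (v (m.1.2 1)) (v (m.1.2 2))) (v (m.1.2 3)) (v (m.1.2 4))
  else
    A.pats (v (m.1.2 0)) (A.pats (v (m.1.2 1)) (v (m.1.2 2)) (v (m.1.2 3))) (v (m.1.2 4))

/-- The standard basis vector of `ℚ^{Mon5}` at the type-1 monomial with permutation `σ`. -/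
def basis2 (σ : Equiv.Perm (Fin 5)) : Mon5 → ℚ :=
  fun m => if m.1.1 = 1 ∧ m.1.2 = σ then 1 else 0

/-- Coefficient vector of `[aσ,[bσ,cσ,dσ],eσ] + [aσ,[cσ,bσ,dσ],eσ]`. -/
def vecQ1 (σ : Equiv.Perm (Fin 5)) : Mon5 → ℚ :=
  basis2 σ + basis2 (σ * Equiv.swap 1 2)

/-- Coefficient vector of `[aσ,[bσ,cσ,dσ],eσ] − [aσ,[dσ,bσ,cσ],eσ]`. -/
def vecQ2 (σ : Equiv.Perm (Fin 5)) : Mon5 → ℚ :=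
  basis2 σ - basis2 (σ * (Equiv.swap 1 2 * Equiv.swap 1 3))

/-- The 40 coefficient vectors, for `σ` with `σ 1 < σ 2 < σ 3`. -/
def degree5IdentitySet : Set (Mon5 → ℚ) :=
  {x | ∃ σ : Equiv.Perm (Fin 5), (σ 1 < σ 2 ∧ σ 2 < σ 3) ∧ (x = vecQ1 σ ∨ x = vecQ2 σ)}

/-- The alternating ternary sum in an associative ring. -/
def ternarySum {R : Type*} [Ring R] (a b c : R) : R :=
  a * b * c - a * c * b - b * a * c + c * a * b + b * c * a - c * b * a

/-- The dialgebra `R × R` attached to an associative algebra `R`: the first coordinate multiplies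
as in `R`, and the second coordinate of a product comes from the central factor. -/
def prodDialgebra (R : Type*) [Ring R] [Algebra ℚ R] : Dialgebra ℚ (R × R) where
  l := LinearMap.mk₂ ℚ (fun p q => (p.1 * q.1, p.2 * q.1))
    (by intros; ext <;> simp [add_mul]) (by intros; ext <;> simp)
    (by intros; ext <;> simp [mul_add]) (by intros; ext <;> simp)
  r := LinearMap.mk₂ ℚ (fun p q => (p.1 * q.1, p.1 * q.2))
    (by intros; ext <;> simp [add_mul]) (by intros; ext <;> simp)
    (by intros; ext <;> simp [mul_add]) (by intros; ext <;> simp)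
  l_assoc a b c := by ext <;> simp [mul_assoc]
  r_assoc a b c := by ext <;> simp [mul_assoc]
  inner_assoc a b c := by ext <;> simp [mul_assoc]
  bar_right a b c := by ext <;> simp
  bar_left a b c := by ext <;> simp

lemma prodDialgebra_pats {R : Type*} [Ring R] [Algebra ℚ R] (p q s : R × R) :
    (prodDialgebra R).pats p q s = (ternarySum p.1 q.1 s.1, ternarySum p.2 q.1 s.1) := by
  ext <;> simp [Dialgebra.pats, prodDialgebra, ternarySum, mul_assoc]

lemma ternarySum_zero_left {R : Type*} [Ring R] (b c : R) : ternarySum 0 b c = 0 := by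
  simp [ternarySum]

/-- The signed sum of the values of `f` on the six concatenations of three words. -/
def altSum {α : Type*} (f : List α → ℤ) (u v w : List α) : ℤ :=
  f (u ++ v ++ w) - f (u ++ w ++ v) - f (v ++ u ++ w) + f (w ++ u ++ v) + f (v ++ w ++ u)
    - f (w ++ v ++ u)

/-- The value of `f` on the expansion of the degree-5 monomial of type `t` in the letters
`a, b, c, d, e`. -/
def wordEval (f : List (Fin 5) → ℤ) (t : Fin 2) (a b c d e : Fin 5) : ℤ :=
  if t = 0 then altSum (fun w => altSum f w [d] [e]) [a] [b] [c]
  else altSum (fun w => altSum f [a] w [e]) [b] [c] [d]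

/-- The linear functional on the free associative algebra with prescribed values on words. -/
noncomputable def wordFunctional (f : List (Fin 5) → ℤ) :
    MonoidAlgebra ℚ (FreeMonoid (Fin 5)) →ₗ[ℚ] ℚ :=
  Finsupp.linearCombination ℚ (fun w : FreeMonoid (Fin 5) => (f w.toList : ℚ)) ∘ₗ
    (MonoidAlgebra.coeffLinearEquiv ℚ).toLinearMap

/-- The generators of the free associative algebra on five letters. -/
noncomputable def letter (i : Fin 5) : MonoidAlgebra ℚ (FreeMonoid (Fin 5)) :=
  MonoidAlgebra.single (FreeMonoid.of i) 1

lemma wordFunctional_single (f : List (Fin 5) → ℤ) (w : FreeMonoid (Fin 5)) :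
    wordFunctional f (MonoidAlgebra.single w 1) = f w.toList := by
  simp [wordFunctional]

lemma wordFunctional_left (f : List (Fin 5) → ℤ) (a b c d e : Fin 5) :
    wordFunctional f (ternarySum (ternarySum (letter a) (letter b) (letter c)) (letter d)
      (letter e)) = wordEval f 0 a b c d e := by
  simp only [ternarySum, letter, mul_sub, mul_add, sub_mul, add_mul,
    MonoidAlgebra.single_mul_single, map_sub, map_add, mul_one, wordFunctional_single]
  simp [wordEval, altSum]
  ring

lemma wordFunctional_middle (f : List (Fin 5) → ℤ) (a b c d e : Fin 5) :
    wordFunctional f (ternarySum (letter a) (ternarySum (letter b) (letter c) (letter d))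
      (letter e)) = wordEval f 1 a b c d e := by
  simp only [ternarySum, letter, mul_sub, mul_add, sub_mul, add_mul,
    MonoidAlgebra.single_mul_single, map_sub, map_add, mul_one, wordFunctional_single]
  simp [wordEval, altSum]
  ring

/-- A functional detecting the monomial `((0,1,2),3,4)`. -/
def leftWeight (w : List (Fin 5)) : ℤ :=
  if w = [4, 0, 2, 1, 3] then -1 else if w = [2, 1, 3, 0, 4] then -1
  else if w = [2, 1, 0, 3, 4] then -2 else if w = [1, 3, 0, 4, 2] then -1 else 0

/-- A functional detecting the monomial `(0,(1,2,3),4)`. -/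
def middleWeight (w : List (Fin 5)) : ℤ :=
  if w = [4, 3, 1, 0, 2] then -1 else if w = [0, 2, 1, 3, 4] then -2
  else if w = [3, 4, 1, 2, 0] then -1 else if w = [0, 3, 1, 2, 4] then 1 else 0

lemma wordEval_leftWeight_left : ∀ b c d e : Fin 5, wordEval leftWeight 0 0 b c d e = 0 ∨
    ((b = 1 ∧ c = 2 ∨ b = 2 ∧ c = 1) ∧ (d = 3 ∧ e = 4 ∨ d = 4 ∧ e = 3)) := by
  decide +kernel

lemma wordEval_leftWeight_middle : ∀ b c d e : Fin 5, wordEval leftWeight 1 0 b c d e = 0 := by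
  decide +kernel

lemma wordEval_middleWeight_left : ∀ b c d e : Fin 5,
    wordEval middleWeight 0 0 b c d e = 0 := by
  decide +kernel

lemma wordEval_middleWeight_middle : ∀ b c d e : Fin 5, wordEval middleWeight 1 0 b c d e = 0 ∨
    e = 4 ∧ (b = 1 ∧ (c = 2 ∧ d = 3 ∨ c = 3 ∧ d = 2) ∨ b = 2 ∧ (c = 1 ∧ d = 3 ∨ c = 3 ∧ d = 1) ∨
      b = 3 ∧ (c = 1 ∧ d = 2 ∨ c = 2 ∧ d = 1)) := by
  decide +kernel

/-- The property of being the coefficient vector of an identity of the PATS. -/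
def IsIdentityVector (x : Mon5 → ℚ) : Prop :=
  ∀ (D : Type) [AddCommGroup D] [Module ℚ D] (A : Dialgebra ℚ D) (v : Fin 5 → D),
    ∑ m : Mon5, x m • evalMon5 A v m = 0

/-- The monomial `((τ 0, τ 1, τ 2), τ 3, τ 4)`. -/
def leftMon (τ : Equiv.Perm (Fin 5)) (h : τ 1 < τ 2 ∧ τ 3 < τ 4) : Mon5 :=
  ⟨(0, τ), fun _ => h, fun h' => absurd h' zero_ne_one⟩

/-- The monomial `(τ 0, (τ 1, τ 2, τ 3), τ 4)`. -/
def middleMon (τ : Equiv.Perm (Fin 5)) (h : τ 2 < τ 3) : Mon5 :=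
  ⟨(1, τ), fun h' => absurd h' one_ne_zero, fun _ => h⟩

lemma Mon5.eq_leftMon_or_middleMon (m : Mon5) :
    (∃ τ h, m = leftMon τ h) ∨ ∃ τ h, m = middleMon τ h := by
  obtain ⟨⟨t, τ⟩, h0, h1⟩ := m
  fin_cases t
  · exact Or.inl ⟨τ, h0 rfl, rfl⟩
  · exact Or.inr ⟨τ, h1 rfl, rfl⟩

lemma leftMon_inj {τ τ' : Equiv.Perm (Fin 5)} {h h'} (e : τ = τ') :
    leftMon τ h = leftMon τ' h' := by
  subst e
  rfl

lemma middleMon_inj {τ τ' : Equiv.Perm (Fin 5)} {h h'} :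
    middleMon τ h = middleMon τ' h' ↔ τ = τ' := by
  refine ⟨fun e => congrArg (fun m : Mon5 => m.1.2) e, ?_⟩
  rintro rfl
  rfl

lemma leftMon_ne_middleMon {τ τ' : Equiv.Perm (Fin 5)} {h h'} :
    leftMon τ h ≠ middleMon τ' h' :=
  fun e => zero_ne_one (congrArg (fun m : Mon5 => m.1.1) e)

lemma evalMon5_leftMon {D : Type} [AddCommGroup D] [Module ℚ D] (A : Dialgebra ℚ D)
    (v : Fin 5 → D) (τ : Equiv.Perm (Fin 5)) (h) : evalMon5 A v (leftMon τ h) =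
      A.pats (A.pats (v (τ 0)) (v (τ 1)) (v (τ 2))) (v (τ 3)) (v (τ 4)) :=
  rfl

lemma evalMon5_middleMon {D : Type} [AddCommGroup D] [Module ℚ D] (A : Dialgebra ℚ D)
    (v : Fin 5 → D) (τ : Equiv.Perm (Fin 5)) (h) : evalMon5 A v (middleMon τ h) =
      A.pats (v (τ 0)) (A.pats (v (τ 1)) (v (τ 2)) (v (τ 3))) (v (τ 4)) :=
  rfl

lemma basis2_leftMon (σ τ : Equiv.Perm (Fin 5)) (h) : basis2 σ (leftMon τ h) = 0 :=
  if_neg fun e => zero_ne_one e.1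

lemma basis2_middleMon (σ τ : Equiv.Perm (Fin 5)) (h) :
    basis2 σ (middleMon τ h) = if τ = σ then 1 else 0 := by
  have : (1 : Fin 2) = 1 ∧ τ = σ ↔ τ = σ := by simp
  exact if_congr this rfl rfl

/-- The value of `f` on the component of a monomial with center `σ 0`, after renaming letters
along `σ⁻¹`. -/
def monEval (f : List (Fin 5) → ℤ) (σ : Equiv.Perm (Fin 5)) (m : Mon5) : ℤ :=
  if m.1.2 0 = σ 0 then wordEval f m.1.1 0 (σ⁻¹ (m.1.2 1)) (σ⁻¹ (m.1.2 2)) (σ⁻¹ (m.1.2 3))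
    (σ⁻¹ (m.1.2 4)) else 0

lemma monEval_leftMon (f : List (Fin 5) → ℤ) (σ τ : Equiv.Perm (Fin 5)) (h) :
    monEval f σ (leftMon τ h) = if τ 0 = σ 0 then
      wordEval f 0 0 (σ⁻¹ (τ 1)) (σ⁻¹ (τ 2)) (σ⁻¹ (τ 3)) (σ⁻¹ (τ 4)) else 0 :=
  rfl

lemma monEval_middleMon (f : List (Fin 5) → ℤ) (σ τ : Equiv.Perm (Fin 5)) (h) :
    monEval f σ (middleMon τ h) = if τ 0 = σ 0 then
      wordEval f 1 0 (σ⁻¹ (τ 1)) (σ⁻¹ (τ 2)) (σ⁻¹ (τ 3)) (σ⁻¹ (τ 4)) else 0 :=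
  rfl

lemma wordFunctional_evalMon5 (f : List (Fin 5) → ℤ) (σ : Equiv.Perm (Fin 5)) (m : Mon5) :
    wordFunctional f (evalMon5 (prodDialgebra _)
      (fun i => (letter (σ⁻¹ i), if σ⁻¹ i = 0 then letter 0 else 0)) m).2 = monEval f σ m := by
  obtain ⟨τ, h, rfl⟩ | ⟨τ, h, rfl⟩ := m.eq_leftMon_or_middleMon
  all_goals
    have h0 : σ⁻¹ (τ 0) = 0 ↔ τ 0 = σ 0 := Equiv.Perm.inv_eq_iff_eq
    by_cases h1 : τ 0 = σ 0
  · rw [evalMon5_leftMon, monEval_leftMon, if_pos h1, ← wordFunctional_left]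
    simp only [prodDialgebra_pats, if_pos (h0.2 h1)]
  · rw [evalMon5_leftMon, monEval_leftMon, if_neg h1]
    simp only [prodDialgebra_pats, if_neg (mt h0.1 h1), ternarySum_zero_left, map_zero,
      Int.cast_zero]
  · rw [evalMon5_middleMon, monEval_middleMon, if_pos h1, ← wordFunctional_middle]
    simp only [prodDialgebra_pats, if_pos (h0.2 h1)]
  · rw [evalMon5_middleMon, monEval_middleMon, if_neg h1]
    simp only [prodDialgebra_pats, if_neg (mt h0.1 h1), ternarySum_zero_left, map_zero,
      Int.cast_zero]

lemma IsIdentityVector.sum_monEval {x : Mon5 → ℚ} (hx : IsIdentityVector x)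
    (f : List (Fin 5) → ℤ) (σ : Equiv.Perm (Fin 5)) :
    ∑ m : Mon5, x m * (monEval f σ m : ℚ) = 0 := by
  have h := congrArg (fun p => wordFunctional f p.2) (hx _ (prodDialgebra _)
    (fun i => (letter (σ⁻¹ i), if σ⁻¹ i = 0 then letter 0 else 0)))
  simpa only [Prod.snd_sum, map_sum, Prod.snd_zero, map_zero, Prod.smul_snd, map_smul,
    smul_eq_mul, wordFunctional_evalMon5] using h

lemma perm_ext {σ τ : Equiv.Perm (Fin 5)} (h0 : σ 0 = τ 0) (h1 : σ 1 = τ 1) (h2 : σ 2 = τ 2)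
    (h3 : σ 3 = τ 3) (h4 : σ 4 = τ 4) : σ = τ := by
  ext i
  fin_cases i
  · exact congrArg _ h0
  · exact congrArg _ h1
  · exact congrArg _ h2
  · exact congrArg _ h3
  · exact congrArg _ h4

lemma IsIdentityVector.apply_leftMon {x : Mon5 → ℚ} (hx : IsIdentityVector x)
    (σ : Equiv.Perm (Fin 5)) (h) : x (leftMon σ h) = 0 := by
  have hs := hx.sum_monEval leftWeight σ
  rw [Finset.sum_eq_single (leftMon σ h)] at hs
  · rw [monEval_leftMon, if_pos rfl] at hs
    have hinv (i : Fin 5) : σ⁻¹ (σ i) = i := σ.symm_apply_apply i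
    rw [hinv, hinv, hinv, hinv, show wordEval leftWeight 0 0 1 2 3 4 = 3 by decide +kernel] at hs
    simpa using hs
  · intro m _ hm
    obtain ⟨τ, h', rfl⟩ | ⟨τ, h', rfl⟩ := m.eq_leftMon_or_middleMon
    · rw [monEval_leftMon]
      split_ifs with h0
      · obtain hz | hz := wordEval_leftWeight_left (σ⁻¹ (τ 1)) (σ⁻¹ (τ 2)) (σ⁻¹ (τ 3))
          (σ⁻¹ (τ 4))
        · rw [hz]
          simp
        · simp only [Equiv.Perm.inv_eq_iff_eq] at hz
          obtain ⟨⟨h1, h2⟩ | ⟨h1, h2⟩, ⟨h3, h4⟩ | ⟨h3, h4⟩⟩ := hz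
          · exact absurd (leftMon_inj (perm_ext h0 h1 h2 h3 h4)) hm
          · exact absurd (h4 ▸ h3 ▸ h'.2) h.2.asymm
          · exact absurd (h2 ▸ h1 ▸ h'.1) h.1.asymm
          · exact absurd (h2 ▸ h1 ▸ h'.1) h.1.asymm
      · simp
    · rw [monEval_middleMon, wordEval_leftWeight_middle]
      simp
  · simp

/-- The permutations of the five letters increasing on the three middle positions. -/
abbrev SortedPerm : Type := {σ : Equiv.Perm (Fin 5) // σ 1 < σ 2 ∧ σ 2 < σ 3}

/-- The permutations `1`, `(1 2)`, `(1 3 2)` of the three middle positions. -/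
def shuffle : Fin 3 → Equiv.Perm (Fin 5) :=
  ![1, Equiv.swap 1 2, Equiv.swap 1 2 * Equiv.swap 1 3]

lemma shuffle_lt (σ : SortedPerm) (i : Fin 3) :
    (σ.1 * shuffle i) 2 < (σ.1 * shuffle i) 3 := by
  obtain ⟨σ, h1, h2⟩ := σ
  fin_cases i
  · exact h2
  · exact h1.trans h2
  · exact h1

/-- The three monomials of the second type with the same center and last letter. -/
def sortedMon (σ : SortedPerm) (i : Fin 3) : Mon5 :=
  middleMon (σ.1 * shuffle i) (shuffle_lt σ i)

lemma sortedMon_inj {σ σ' : SortedPerm} {i j : Fin 3} :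
    sortedMon σ i = sortedMon σ' j ↔ σ = σ' ∧ i = j := by
  refine ⟨fun e => ?_, by rintro ⟨rfl, rfl⟩; rfl⟩
  have e := middleMon_inj.1 e
  suffices h : i = j by
    subst h
    exact ⟨Subtype.ext (mul_right_cancel e), rfl⟩
  obtain ⟨σ, hσ⟩ := σ
  obtain ⟨σ', hσ'⟩ := σ'
  have e1 := congrArg (fun τ => τ 1) e
  have e2 := congrArg (fun τ => τ 2) e
  have e3 := congrArg (fun τ => τ 3) e
  clear e
  simp only [Equiv.Perm.mul_apply] at e1 e2 e3
  have s01 : shuffle 0 1 = 1 := by decide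
  have s02 : shuffle 0 2 = 2 := by decide
  have s03 : shuffle 0 3 = 3 := by decide
  have s11 : shuffle 1 1 = 2 := by decide
  have s12 : shuffle 1 2 = 1 := by decide
  have s13 : shuffle 1 3 = 3 := by decide
  have s21 : shuffle 2 1 = 3 := by decide
  have s22 : shuffle 2 2 = 1 := by decide
  have s23 : shuffle 2 3 = 2 := by decide
  fin_cases i <;> fin_cases j <;>
    simp only [Fin.mk_zero, Fin.mk_one, Fin.reduceFinMk, s01, s02, s03, s11, s12, s13,
      s21, s22, s23] at e1 e2 e3 ⊢ <;> omega

lemma monEval_sortedMon (f : List (Fin 5) → ℤ) (σ : SortedPerm) (i : Fin 3) :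
    monEval f σ.1 (sortedMon σ i) =
      wordEval f 1 0 (shuffle i 1) (shuffle i 2) (shuffle i 3) (shuffle i 4) := by
  have h0 : shuffle i 0 = 0 := by
    revert i
    decide
  have hinv (j : Fin 5) : σ.1⁻¹ (σ.1 j) = j := σ.1.symm_apply_apply j
  rw [sortedMon, monEval_middleMon, if_pos (by rw [Equiv.Perm.mul_apply, h0])]
  simp only [Equiv.Perm.mul_apply, hinv]

lemma exists_sortedMon (τ : Equiv.Perm (Fin 5)) (h : τ 2 < τ 3) :
    ∃ σ i, middleMon τ h = sortedMon σ i := by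
  suffices ∃ i, ((τ * (shuffle i)⁻¹) 1 < (τ * (shuffle i)⁻¹) 2 ∧
      (τ * (shuffle i)⁻¹) 2 < (τ * (shuffle i)⁻¹) 3) by
    obtain ⟨i, hi⟩ := this
    exact ⟨⟨_, hi⟩, i, middleMon_inj.2 (by simp)⟩
  simp only [Equiv.Perm.mul_apply]
  have h12 : τ 1 ≠ τ 2 := τ.injective.ne (by decide)
  have h13 : τ 1 ≠ τ 3 := τ.injective.ne (by decide)
  obtain h1 | h1 := h12.lt_or_gt
  · exact ⟨0, h1, h⟩
  obtain h2 | h2 := h13.lt_or_gt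
  · exact ⟨1, h1, h2⟩
  · exact ⟨2, h, h2⟩

lemma IsIdentityVector.apply_sortedMon {x : Mon5 → ℚ} (hx : IsIdentityVector x)
    (σ : SortedPerm) : x (sortedMon σ 0) - x (sortedMon σ 1) + x (sortedMon σ 2) = 0 := by
  classical
  have hs := hx.sum_monEval middleWeight σ.1
  rw [← Finset.sum_subset (Finset.subset_univ {sortedMon σ 0, sortedMon σ 1, sortedMon σ 2}),
    Finset.sum_insert (by simp [sortedMon_inj]), Finset.sum_pair (by simp [sortedMon_inj])] at hs
  · have v0 : monEval middleWeight σ.1 (sortedMon σ 0) = 3 := by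
      rw [monEval_sortedMon]
      decide +kernel
    have v1 : monEval middleWeight σ.1 (sortedMon σ 1) = -3 := by
      rw [monEval_sortedMon]
      decide +kernel
    have v2 : monEval middleWeight σ.1 (sortedMon σ 2) = 3 := by
      rw [monEval_sortedMon]
      decide +kernel
    rw [v0, v1, v2] at hs
    push_cast at hs
    linarith
  · intro m _ hm
    obtain ⟨τ, h', rfl⟩ | ⟨τ, h', rfl⟩ := m.eq_leftMon_or_middleMon
    · rw [monEval_leftMon, wordEval_middleWeight_left]
      simp
    · rw [monEval_middleMon]
      split_ifs with h0
      · obtain hz | hz := wordEval_middleWeight_middle (σ.1⁻¹ (τ 1)) (σ.1⁻¹ (τ 2))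
          (σ.1⁻¹ (τ 3)) (σ.1⁻¹ (τ 4))
        · rw [hz]
          simp
        · refine absurd ?_ hm
          simp only [Equiv.Perm.inv_eq_iff_eq] at hz
          obtain ⟨σ, h12, h23⟩ := σ
          simp only [Finset.mem_insert, Finset.mem_singleton, sortedMon, middleMon_inj]
          obtain ⟨h4, ⟨h1, ⟨h2, h3⟩ | ⟨h2, h3⟩⟩ | ⟨h1, ⟨h2, h3⟩ | ⟨h2, h3⟩⟩ |
            ⟨h1, ⟨h2, h3⟩ | ⟨h2, h3⟩⟩⟩ := hz
          · exact Or.inl (perm_ext h0 h1 h2 h3 h4)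
          · exact absurd (h3 ▸ h2 ▸ h') h23.asymm
          · exact Or.inr (Or.inl (perm_ext h0 h1 h2 h3 h4))
          · exact absurd (h3 ▸ h2 ▸ h') (h12.trans h23).asymm
          · exact Or.inr (Or.inr (perm_ext h0 h1 h2 h3 h4))
          · exact absurd (h3 ▸ h2 ▸ h') h12.asymm
      · simp

lemma basis2_sortedMon (σ σ' : SortedPerm) (i j : Fin 3) :
    basis2 (σ.1 * shuffle i) (sortedMon σ' j) = if σ' = σ ∧ j = i then 1 else 0 := by
  rw [sortedMon, basis2_middleMon]
  refine if_congr ?_ rfl rfl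
  rw [← sortedMon_inj, sortedMon, sortedMon, middleMon_inj]

lemma vecQ1_eq (σ : SortedPerm) :
    vecQ1 σ.1 = basis2 (σ.1 * shuffle 0) + basis2 (σ.1 * shuffle 1) :=
  rfl

lemma vecQ2_eq (σ : SortedPerm) :
    vecQ2 σ.1 = basis2 (σ.1 * shuffle 0) - basis2 (σ.1 * shuffle 2) :=
  rfl

/-- The spanning family of `degree5IdentitySet`, indexed by its natural index type. -/
def identityFamily : SortedPerm ⊕ SortedPerm → Mon5 → ℚ :=
  Sum.elim (fun σ => vecQ1 σ.1) (fun σ => vecQ2 σ.1)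

lemma degree5IdentitySet_eq_range : degree5IdentitySet = Set.range identityFamily := by
  ext x
  constructor
  · rintro ⟨σ, hσ, rfl | rfl⟩
    · exact ⟨Sum.inl ⟨σ, hσ⟩, rfl⟩
    · exact ⟨Sum.inr ⟨σ, hσ⟩, rfl⟩
  · rintro ⟨σ | σ, rfl⟩
    · exact ⟨σ.1, σ.2, Or.inl rfl⟩
    · exact ⟨σ.1, σ.2, Or.inr rfl⟩

lemma linearIndependent_identityFamily : LinearIndependent ℚ identityFamily := by
  rw [Fintype.linearIndependent_iff]
  intro g hg
  rw [Fintype.sum_sum_type] at hg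
  rintro (σ | σ)
  · have h := congrFun hg (sortedMon σ 1)
    simpa [identityFamily, vecQ1_eq, vecQ2_eq, basis2_sortedMon] using h
  · have h := congrFun hg (sortedMon σ 2)
    simpa [identityFamily, vecQ1_eq, vecQ2_eq, basis2_sortedMon] using h

lemma IsIdentityVector.mem_span {x : Mon5 → ℚ} (hx : IsIdentityVector x) :
    x ∈ Submodule.span ℚ degree5IdentitySet := by
  have key : x = ∑ σ : SortedPerm,
      (x (sortedMon σ 1) • vecQ1 σ.1 - x (sortedMon σ 2) • vecQ2 σ.1) := by
    ext m
    rw [Finset.sum_apply]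
    obtain ⟨τ, h, rfl⟩ | ⟨τ, h, rfl⟩ := m.eq_leftMon_or_middleMon
    · simp [hx.apply_leftMon, vecQ1, vecQ2, basis2_leftMon]
    · obtain ⟨σ, i, hi⟩ := exists_sortedMon τ h
      rw [hi, Finset.sum_eq_single σ]
      · have h := hx.apply_sortedMon σ
        simp only [Pi.sub_apply, Pi.add_apply, Pi.smul_apply, smul_eq_mul, vecQ1_eq, vecQ2_eq,
          basis2_sortedMon]
        fin_cases i <;> simp
        linarith
      · intro σ' _ hσ
        simp [vecQ1_eq, vecQ2_eq, basis2_sortedMon, hσ.symm]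
      · simp
  rw [key]
  exact Submodule.sum_mem _ fun σ _ => Submodule.sub_mem _
    (Submodule.smul_mem _ _ (Submodule.subset_span ⟨σ.1, σ.2, Or.inl rfl⟩))
    (Submodule.smul_mem _ _ (Submodule.subset_span ⟨σ.1, σ.2, Or.inr rfl⟩))

lemma sum_basis2_smul {D : Type*} [AddCommGroup D] [Module ℚ D] (F : Mon5 → D)
    (σ : SortedPerm) (i : Fin 3) :
    ∑ m : Mon5, basis2 (σ.1 * shuffle i) m • F m = F (sortedMon σ i) := by
  rw [Finset.sum_eq_single (sortedMon σ i)]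
  · simp [basis2_sortedMon]
  · intro m _ hm
    obtain ⟨τ, h, rfl⟩ | ⟨τ, h, rfl⟩ := m.eq_leftMon_or_middleMon
    · rw [basis2_leftMon, zero_smul]
    · rw [basis2_middleMon, if_neg fun e => hm (middleMon_inj.2 e), zero_smul]
  · simp

lemma Dialgebra.pats_middle_swap {k D : Type*} [CommRing k] [AddCommGroup D] [Module k D]
    (A : Dialgebra k D) (a b c d e : D) :
    A.pats a (A.pats c b d) e = -A.pats a (A.pats b c d) e := by
  simp only [Dialgebra.pats, map_add, map_sub, LinearMap.add_apply, LinearMap.sub_apply,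
    A.l_assoc, A.r_assoc, A.inner_assoc, A.bar_right, A.bar_left]
  simp only [← A.bar_left]
  abel

lemma Dialgebra.pats_swap_right {k D : Type*} [CommRing k] [AddCommGroup D] [Module k D]
    (A : Dialgebra k D) (a b c : D) : A.pats a c b = -A.pats a b c := by
  simp only [Dialgebra.pats]
  abel

lemma Dialgebra.pats_middle_cycle {k D : Type*} [CommRing k] [AddCommGroup D] [Module k D]
    (A : Dialgebra k D) (a b c d e : D) :
    A.pats a (A.pats d b c) e = A.pats a (A.pats b c d) e := by
  rw [A.pats_middle_swap a b d c e, A.pats_swap_right b c d]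
  simp [Dialgebra.pats]
  abel

lemma isIdentityVector_of_mem_span {x : Mon5 → ℚ}
    (hx : x ∈ Submodule.span ℚ degree5IdentitySet) : IsIdentityVector x := by
  intro D _ _ A v
  induction hx using Submodule.span_induction with
  | mem x hx =>
    obtain ⟨σ, hσ, rfl | rfl⟩ := hx
    · rw [vecQ1_eq ⟨σ, hσ⟩]
      simp only [Pi.add_apply, add_smul, Finset.sum_add_distrib,
        sum_basis2_smul _ ⟨σ, hσ⟩]
      exact add_eq_zero_iff_neg_eq.2 (A.pats_middle_swap ..).symm
    · rw [vecQ2_eq ⟨σ, hσ⟩]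
      simp only [Pi.sub_apply, sub_smul, Finset.sum_sub_distrib,
        sum_basis2_smul _ ⟨σ, hσ⟩]
      exact sub_eq_zero.2 (A.pats_middle_cycle ..).symm
  | zero => simp
  | add x y _ _ hx hy => simp [add_smul, Finset.sum_add_distrib, hx, hy]
  | smul c x _ hx => simp [mul_smul, ← Finset.smul_sum, hx]

lemma card_sortedPerm : Fintype.card SortedPerm = 20 := by
  decide +kernel

/-- a coefficient vector `x ∈ ℚ^{Mon5}` gives an identity of the PATS in
every associative dialgebra over `ℚ` iff it lies in the span of the 40 vectors
`vecQ1 σ`, `vecQ2 σ` (`σ 1 < σ 2 < σ 3`); this span has dimension 40.  In particular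
every multilinear identity of degree ≤ 5 of the PATS follows from `P ≡ 0`, `Q ≡ 0`. -/
theorem degree5_identities :
    (∀ x : Mon5 → ℚ,
      (∀ (D : Type) [AddCommGroup D] [Module ℚ D] (A : Dialgebra ℚ D) (v : Fin 5 → D),
          ∑ m : Mon5, x m • evalMon5 A v m = 0)
        ↔ x ∈ Submodule.span ℚ degree5IdentitySet) ∧
    Module.finrank ℚ ↥(Submodule.span ℚ degree5IdentitySet) = 40 := by
  refine ⟨fun x => ⟨fun hx => IsIdentityVector.mem_span hx, isIdentityVector_of_mem_span⟩, ?_⟩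
  rw [degree5IdentitySet_eq_range, finrank_span_eq_card linearIndependent_identityFamily,
    Fintype.card_sum, card_sortedPerm]
end

section
/- Let D be an associative dialgebra and let x be any product of elements a₁,…,aₙ ∈ D formed with some placement of parentheses and some choice of the operations ⊣ and ⊢ at each step. Define the center of such a product inductively: the center of a single factor a is a; the center of y⊣z is the center of y; the center of y⊢z is the center of z. If the center of x is the i-th factor aᵢ, then x = (a₁ ⊢ ⋯ ⊢ a_{i−1}) ⊢ aᵢ ⊣ (a_{i+1} ⊣ ⋯ ⊣ aₙ). -/
/-- A dialgebra monomial: a product of elements of `D` with some placement of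
parentheses and some choice of operations (`⊣` = `left`, `⊢` = `right`). -/
inductive DiaWord (D : Type*) where
  | leaf : D → DiaWord D
  | left : DiaWord D → DiaWord D → DiaWord D
  | right : DiaWord D → DiaWord D → DiaWord D

namespace DiaWord

variable {k D : Type*} [CommRing k] [AddCommGroup D] [Module k D]

/-- Evaluation of a dialgebra monomial in a dialgebra. -/
def eval (A : Dialgebra k D) : DiaWord D → D
  | leaf a => a
  | left y z => A.l (eval A y) (eval A z)
  | right y z => A.r (eval A y) (eval A z)

/-- The list of factors `a₁, …, aₙ` of a monomial, in order. -/
def leaves {D : Type*} : DiaWord D → List D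
  | leaf a => [a]
  | left y z => leaves y ++ leaves z
  | right y z => leaves y ++ leaves z

/-- The center of a monomial: `c(a) = a`, `c(y ⊣ z) = c(y)`, `c(y ⊢ z) = c(z)`. -/
def center {D : Type*} : DiaWord D → D
  | leaf a => a
  | left y _ => center y
  | right _ z => center z

/-- The (0-based) position of the center among the factors. -/
def centerPos {D : Type*} : DiaWord D → ℕ
  | leaf _ => 0
  | left y _ => centerPos y
  | right y z => (leaves y).length + centerPos z

end DiaWord

namespace DiaWord

variable {k D : Type*} [CommRing k] [AddCommGroup D] [Module k D]

lemma l_eval_eq_foldl (A : Dialgebra k D) (w : DiaWord D) (d : D) :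
    A.l d (w.eval A) = w.leaves.foldl (fun x y => A.l x y) d := by
  induction w generalizing d with
  | leaf a => rfl
  | left y z ihy ihz => rw [eval, leaves, List.foldl_append, ← ihy, ← ihz, A.l_assoc]
  | right y z ihy ihz =>
    rw [eval, leaves, List.foldl_append, ← ihy, ← ihz, A.l_assoc, A.bar_left]

lemma r_eval_eq_foldr (A : Dialgebra k D) (w : DiaWord D) (d : D) :
    A.r (w.eval A) d = w.leaves.foldr (fun x y => A.r x y) d := by
  induction w generalizing d with
  | leaf a => rfl
  | left y z ihy ihz =>
    rw [eval, leaves, List.foldr_append, ← ihz, ← ihy, A.bar_right, A.r_assoc]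
  | right y z ihy ihz => rw [eval, leaves, List.foldr_append, ← ihz, ← ihy, A.r_assoc]

lemma centerPos_lt_length_leaves {D : Type*} (w : DiaWord D) :
    w.centerPos < w.leaves.length := by
  induction w with
  | leaf a => simp [centerPos, leaves]
  | left y z ihy ihz => simp only [centerPos, leaves, List.length_append]; lia
  | right y z ihy ihz => simp only [centerPos, leaves, List.length_append]; lia

end DiaWord

lemma Dialgebra.l_foldr_r {k D : Type*} [CommRing k] [AddCommGroup D] [Module k D]
    (A : Dialgebra k D) (L : List D) (d c : D) :
    A.l (L.foldr (fun x y => A.r x y) d) c = L.foldr (fun x y => A.r x y) (A.l d c) := by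
  induction L with
  | nil => rfl
  | cons a L ih => rw [List.foldr_cons, List.foldr_cons, A.inner_assoc, ih]

/-- if the center of a dialgebra monomial `x` with factors `a₁ … aₙ` is
the `i`-th factor `aᵢ`, then `x = (a₁ ⊢ ⋯ ⊢ a_{i−1}) ⊢ aᵢ ⊣ (a_{i+1} ⊣ ⋯ ⊣ aₙ)`. -/
theorem diaword_normal_form
    (k D : Type*) [CommRing k] [AddCommGroup D] [Module k D]
    (A : Dialgebra k D) (w : DiaWord D) :
    w.eval A =
      (w.leaves.take w.centerPos).foldr (fun x y => A.r x y)
        ((w.leaves.drop (w.centerPos + 1)).foldl (fun x y => A.l x y) w.center) := by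
  induction w with
  | leaf a => rfl
  | left y z ihy ihz =>
    have h := y.centerPos_lt_length_leaves
    rw [DiaWord.eval, DiaWord.leaves, DiaWord.centerPos, DiaWord.center,
      List.take_append_of_le_length h.le, List.drop_append_of_le_length h, List.foldl_append,
      ← DiaWord.l_eval_eq_foldl, ihy, A.l_foldr_r]
  | right y z ihy ihz =>
    rw [DiaWord.eval, DiaWord.leaves, DiaWord.centerPos, DiaWord.center, add_assoc,
      List.take_length_add_append, List.drop_length_add_append, List.foldr_append,
      ← DiaWord.r_eval_eq_foldr, ← ihz]
end

section
/- In every associative dialgebra D, the dicommutator [a,b] := a⊣b − b⊢a satisfies the Leibniz identity [[a,b],c] = [[a,c],b] + [a,[b,c]] for all a,b,c ∈ D; hence every associative dialgebra becomes a Leibniz algebra under the dicommutator. -/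
/-- The dicommutator `[a,b] = a ⊣ b − b ⊢ a`. -/
def Dialgebra.dicomm {k D : Type*} [CommRing k] [AddCommGroup D] [Module k D]
    (A : Dialgebra k D) (a b : D) : D :=
  A.l a b - A.r b a

/-- the dicommutator of an associative dialgebra satisfies the Leibniz
identity `[[a,b],c] = [[a,c],b] + [a,[b,c]]`; hence every associative dialgebra
becomes a Leibniz algebra under the dicommutator. -/
theorem dicommutator_leibniz
    (k D : Type*) [CommRing k] [AddCommGroup D] [Module k D]
    (A : Dialgebra k D) (a b c : D) :
    A.dicomm (A.dicomm a b) c = A.dicomm (A.dicomm a c) b + A.dicomm a (A.dicomm b c) := by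
  simp only [Dialgebra.dicomm, map_sub, LinearMap.sub_apply, A.l_assoc, A.inner_assoc,
    A.bar_left, A.bar_right, A.r_assoc]
  abel
end

section
/- Let T be a partially alternating ternary algebra and let s be a monomial in pairwise distinct variables built from the ternary product, i.e. a ternary tree whose leaves are the variables. If u is a submonomial of s that occurs as the second or third argument of some submonomial (t,u,v) or (t,v,u) of s, and u = (u₁,u₂,u₃), then for every permutation τ of {1,2,3}, replacing u by (u_{τ(1)},u_{τ(2)},u_{τ(3)}) multiplies the value of s by the sign ε(τ); that is, the second and third arguments of any submonomial of s are completely alternating in their three arguments. -/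
/-- A ternary monomial: a ternary tree whose leaves are elements of `T`. -/
inductive TTree (T : Type*) where
  | leaf : T → TTree T
  | node : TTree T → TTree T → TTree T → TTree T

/-- Evaluation of a ternary monomial in a PATA. -/
def TTree.eval {k T : Type*} [CommRing k] [AddCommGroup T] [Module k T]
    (A : PATA k T) : TTree T → T
  | leaf a => a
  | node x y z => A.t (eval A x) (eval A y) (eval A z)

/-- A one-hole context for ternary monomials. -/
inductive TCtx (T : Type*) where
  | hole : TCtx T
  | node1 : TCtx T → TTree T → TTree T → TCtx T
  | node2 : TTree T → TCtx T → TTree T → TCtx T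
  | node3 : TTree T → TTree T → TCtx T → TCtx T

/-- Filling the hole of a context with a ternary monomial. -/
def TCtx.fill {T : Type*} : TCtx T → TTree T → TTree T
  | hole, u => u
  | node1 c y z, u => TTree.node (fill c u) y z
  | node2 x c z, u => TTree.node x (fill c u) z
  | node3 x y c, u => TTree.node x y (fill c u)

/-- The hole occupies the second or third argument of the submonomial immediately
containing it (so the filled subterm is the second or third argument of some
submonomial of the whole monomial). -/
def TCtx.good {T : Type*} : TCtx T → Prop
  | hole => False
  | node1 c _ _ => good c
  | node2 _ c _ => c = hole ∨ good c
  | node3 _ _ c => c = hole ∨ good c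

/-- A ternary function that changes sign under the two adjacent transpositions of its
arguments is completely alternating. -/
theorem perm_eq_sign_smul_of_swaps {T M : Type*} [AddCommGroup M] (f : T → T → T → M)
    (h₁ : ∀ x y z, f y x z = -f x y z) (h₂ : ∀ x y z, f x z y = -f x y z)
    (v : Fin 3 → T) (τ : Equiv.Perm (Fin 3)) :
    f (v (τ 0)) (v (τ 1)) (v (τ 2))
      = (Equiv.Perm.sign τ : ℤ) • f (v 0) (v 1) (v 2) := by
  have key : ∀ σ : Equiv.Perm (Fin 3),
      σ = 1 ∨ σ = Equiv.swap 0 1 ∨ σ = Equiv.swap 1 2 ∨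
      σ = Equiv.swap 0 1 * Equiv.swap 1 2 ∨ σ = Equiv.swap 1 2 * Equiv.swap 0 1 ∨
      σ = Equiv.swap 0 1 * Equiv.swap 1 2 * Equiv.swap 0 1 := by decide
  have e₀ : Equiv.swap (0 : Fin 3) 1 2 = 2 := by decide
  have e₁ : Equiv.swap (1 : Fin 3) 2 0 = 0 := by decide
  have s₀ : Equiv.Perm.sign (Equiv.swap (0 : Fin 3) 1) = -1 :=
    Equiv.Perm.sign_swap (by decide)
  have s₁ : Equiv.Perm.sign (Equiv.swap (1 : Fin 3) 2) = -1 :=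
    Equiv.Perm.sign_swap (by decide)
  have p₁ := h₁ (v 0) (v 1) (v 2)
  have p₂ := h₂ (v 0) (v 1) (v 2)
  have p₃ : f (v 1) (v 2) (v 0) = f (v 0) (v 1) (v 2) := by rw [h₂ (v 1) (v 0), p₁, neg_neg]
  have p₄ : f (v 2) (v 0) (v 1) = f (v 0) (v 1) (v 2) := by rw [h₁ (v 0) (v 2), p₂, neg_neg]
  have p₅ : f (v 2) (v 1) (v 0) = -f (v 0) (v 1) (v 2) := by rw [h₁ (v 1) (v 2), p₃]
  rcases key τ with rfl | rfl | rfl | rfl | rfl | rfl <;>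
    simp [e₀, e₁, s₀, s₁, p₁, p₂, p₃, p₄, p₅]

namespace PATA

variable {k T : Type*} [CommRing k] [AddCommGroup T] [Module k T] (A : PATA k T)

theorem t_swap_s11 (a b c : T) : A.t a c b = -A.t a b c :=
  eq_neg_of_add_eq_zero_right (A.idP a b c)

theorem t_second_perm (a e : T) (v : Fin 3 → T) (τ : Equiv.Perm (Fin 3)) :
    A.t a (A.t (v (τ 0)) (v (τ 1)) (v (τ 2))) e
      = (Equiv.Perm.sign τ : ℤ) • A.t a (A.t (v 0) (v 1) (v 2)) e :=
  perm_eq_sign_smul_of_swaps (fun x y z => A.t a (A.t x y z) e)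
    (fun x y z => eq_neg_of_add_eq_zero_right (A.idQ a x y z e))
    (fun x y z => by simp [A.t_swap_s11 x y z]) v τ

theorem t_third_perm (a e : T) (v : Fin 3 → T) (τ : Equiv.Perm (Fin 3)) :
    A.t a e (A.t (v (τ 0)) (v (τ 1)) (v (τ 2)))
      = (Equiv.Perm.sign τ : ℤ) • A.t a e (A.t (v 0) (v 1) (v 2)) := by
  rw [A.t_swap_s11 a _ e, A.t_second_perm, A.t_swap_s11 a _ e, smul_neg]

end PATA

/-- in a PATA, if `u = (u₁,u₂,u₃)` occurs as the second or third
argument of some submonomial of `s`, then permuting `u₁,u₂,u₃` by `τ` multiplies the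
value of `s` by `ε(τ)`: such positions are completely alternating. -/
theorem submonomial_completely_alternating
    (k T : Type*) [CommRing k] [AddCommGroup T] [Module k T]
    (A : PATA k T) (c : TCtx T) (hc : c.good) (u : Fin 3 → TTree T)
    (τ : Equiv.Perm (Fin 3)) :
    (c.fill (TTree.node (u (τ 0)) (u (τ 1)) (u (τ 2)))).eval A
      = (Equiv.Perm.sign τ : ℤ) • (c.fill (TTree.node (u 0) (u 1) (u 2))).eval A := by
  induction c with
  | hole => exact hc.elim
  | node1 c y z ih =>
    simp only [TCtx.fill, TTree.eval, ih hc, map_zsmul, LinearMap.smul_apply]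
  | node2 x c z ih =>
    rcases hc with rfl | hc
    · exact A.t_second_perm _ _ (fun i => (u i).eval A) τ
    · simp only [TCtx.fill, TTree.eval, ih hc, map_zsmul, LinearMap.smul_apply]
  | node3 x y c ih =>
    rcases hc with rfl | hc
    · exact A.t_third_perm _ _ (fun i => (u i).eval A) τ
    · simp only [TCtx.fill, TTree.eval, ih hc, map_zsmul]
end

section
/- In every associative dialgebra D over a commutative ring, the PATS satisfies the degree-7 identity 12·R = 0: for all a,b,c,d,e,f,g ∈ D, Σ_{σ∈S₆} ε(σ) [[a,[bσ,cσ,dσ],eσ],fσ,gσ] − Σ_{σ∈S₆} ε(σ) [[a,bσ,cσ],[dσ,eσ,fσ],gσ] = 0, where σ ranges over all permutations of the six letters (b,c,d,e,f,g) and ε(σ) is the sign of σ. -/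
/-- The signed sum of `F (v ∘ σ)` over all permutations `σ` of the six entries of `v`. -/
def alternate {D E : Type*} [AddCommGroup E] (v : Fin 6 → D) :
    ((Fin 6 → D) → E) →+ E where
  toFun F := ∑ σ : Equiv.Perm (Fin 6), (Equiv.Perm.sign σ : ℤ) • F (v ∘ σ)
  map_zero' := by simp
  map_add' F G := by simp [Finset.sum_add_distrib]

theorem alternate_apply {D E : Type*} [AddCommGroup E] (v : Fin 6 → D) (F : (Fin 6 → D) → E) :
    alternate v F = ∑ σ : Equiv.Perm (Fin 6), (Equiv.Perm.sign σ : ℤ) • F (v ∘ σ) := rfl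

theorem alternate_comp_perm {D E : Type*} [AddCommGroup E] (v : Fin 6 → D)
    (F : (Fin 6 → D) → E) (π : Equiv.Perm (Fin 6)) :
    alternate v (fun w => F (w ∘ π)) = (Equiv.Perm.sign π : ℤ) • alternate v F := by
  simp only [alternate_apply, Finset.smul_sum]
  refine Fintype.sum_equiv (Equiv.mulRight π) _ _ fun σ => ?_
  have h : ((Equiv.Perm.sign π : ℤˣ) : ℤ) * (Equiv.Perm.sign π : ℤ) = 1 := by
    rw [← Units.val_mul, Int.units_mul_self, Units.val_one]
  simp only [Equiv.coe_mulRight, Equiv.Perm.sign_mul, Units.val_mul, smul_smul,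
    Equiv.Perm.coe_mul, Function.comp_assoc]
  rw [mul_left_comm, h, mul_one]

/-- The alternating sum does not see an even permutation of the entries. -/
theorem alternate_sub_comp_perm {D E : Type*} [AddCommGroup E] (v : Fin 6 → D)
    (F : (Fin 6 → D) → E) (π : Equiv.Perm (Fin 6)) (hπ : Equiv.Perm.sign π = 1) :
    (fun w => F w - F (w ∘ π)) ∈ (alternate v).ker := by
  rw [AddMonoidHom.mem_ker]
  have h : (fun w => F w - F (w ∘ π)) = F - fun w => F (w ∘ π) := rfl
  rw [h, map_sub, alternate_comp_perm, hπ, Units.val_one, one_smul, sub_self]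

section CommutingFamilies

variable {D E : Type*} [Ring E] (L R : D → E)

/-- Half of the antisymmetric operator `[L b, L c] - [R b, R c] - L b * R c + L c * R b`. -/
def quadraticPart (b c : D) : E := L b * L c - L b * R c - R b * R c

/-- The part of the operator attached to the pair `([b, c, d], e)` in which `b, c, d` occur in
this order. -/
def quarticPart (b c d e : D) : E :=
  L b * L c * L d * L e - L e * (L b * L c * L d) + R b * R c * R d * R e
    - R e * (R b * R c * R d) - L b * L c * L d * R e - L e * (R b * R c * R d)

variable {L R}

theorem alternate_commutator_parts (hLR : ∀ b c, R c * L b = L b * R c) (v : Fin 6 → D) :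
    alternate v (fun w =>
      quadraticPart L R (w 4) (w 5) * quarticPart L R (w 0) (w 1) (w 2) (w 3)
        - quarticPart L R (w 0) (w 1) (w 2) (w 3) * quadraticPart L R (w 4) (w 5)) = 0 := by
  have hLR' (b c : D) (x : E) : R c * (L b * x) = L b * (R c * x) := by
    rw [← mul_assoc, hLR, mul_assoc]
  have h0 := alternate_sub_comp_perm v
    (fun w => L (w 4) * L (w 5) * L (w 0) * L (w 1) * L (w 2) * L (w 3))
    ⟨![2, 3, 4, 5, 0, 1], ![4, 5, 0, 1, 2, 3], by decide, by decide⟩ (by decide)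
  have h1 := alternate_sub_comp_perm v
    (fun w => L (w 4) * L (w 5) * L (w 3) * L (w 0) * L (w 1) * L (w 2))
    ⟨![2, 4, 5, 1, 3, 0], ![5, 3, 0, 4, 1, 2], by decide, by decide⟩ (by decide)
  have h2 := alternate_sub_comp_perm v
    (fun w => L (w 4) * L (w 5) * L (w 0) * L (w 1) * L (w 2) * R (w 3))
    ⟨![2, 4, 5, 3, 0, 1], ![4, 5, 0, 3, 1, 2], by decide, by decide⟩ (by decide)
  have h3 := alternate_sub_comp_perm v
    (fun w => L (w 4) * L (w 5) * L (w 3) * R (w 0) * R (w 1) * R (w 2))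
    ⟨![0, 1, 2, 5, 3, 4], ![0, 1, 2, 4, 5, 3], by decide, by decide⟩ (by decide)
  have h4 := alternate_sub_comp_perm v
    (fun w => L (w 4) * L (w 0) * L (w 1) * L (w 2) * L (w 3) * R (w 5))
    ⟨![1, 2, 3, 4, 0, 5], ![4, 0, 1, 2, 3, 5], by decide, by decide⟩ (by decide)
  have h5 := alternate_sub_comp_perm v
    (fun w => L (w 4) * L (w 3) * L (w 0) * L (w 1) * L (w 2) * R (w 5))
    ⟨![1, 2, 4, 0, 3, 5], ![3, 0, 1, 4, 2, 5], by decide, by decide⟩ (by decide)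
  have h6 := alternate_sub_comp_perm v
    (fun w => L (w 4) * R (w 5) * R (w 0) * R (w 1) * R (w 2) * R (w 3))
    ⟨![1, 2, 3, 5, 4, 0], ![5, 0, 1, 2, 4, 3], by decide, by decide⟩ (by decide)
  have h7 := alternate_sub_comp_perm v
    (fun w => L (w 4) * R (w 5) * R (w 3) * R (w 0) * R (w 1) * R (w 2))
    ⟨![1, 2, 5, 0, 4, 3], ![3, 0, 1, 5, 4, 2], by decide, by decide⟩ (by decide)
  have h8 := alternate_sub_comp_perm v
    (fun w => L (w 4) * L (w 0) * L (w 1) * L (w 2) * R (w 5) * R (w 3))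
    ⟨![1, 2, 4, 5, 0, 3], ![4, 0, 1, 5, 2, 3], by decide, by decide⟩ (by decide)
  have h9 := alternate_sub_comp_perm v
    (fun w => L (w 4) * L (w 3) * R (w 5) * R (w 0) * R (w 1) * R (w 2))
    ⟨![1, 2, 5, 4, 3, 0], ![5, 0, 1, 4, 3, 2], by decide, by decide⟩ (by decide)
  have h10 := alternate_sub_comp_perm v
    (fun w => R (w 4) * R (w 5) * R (w 0) * R (w 1) * R (w 2) * R (w 3))
    ⟨![2, 3, 4, 5, 0, 1], ![4, 5, 0, 1, 2, 3], by decide, by decide⟩ (by decide)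
  have h11 := alternate_sub_comp_perm v
    (fun w => R (w 4) * R (w 5) * R (w 3) * R (w 0) * R (w 1) * R (w 2))
    ⟨![2, 4, 5, 1, 3, 0], ![5, 3, 0, 4, 1, 2], by decide, by decide⟩ (by decide)
  have h12 := alternate_sub_comp_perm v
    (fun w => L (w 0) * L (w 1) * L (w 2) * R (w 4) * R (w 5) * R (w 3))
    ⟨![0, 1, 2, 5, 3, 4], ![0, 1, 2, 4, 5, 3], by decide, by decide⟩ (by decide)
  have h13 := alternate_sub_comp_perm v
    (fun w => L (w 3) * R (w 4) * R (w 5) * R (w 0) * R (w 1) * R (w 2))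
    ⟨![2, 4, 5, 3, 0, 1], ![4, 5, 0, 3, 1, 2], by decide, by decide⟩ (by decide)
  have h := AddMonoidHom.mem_ker.1 <|
    add_mem (add_mem (add_mem (sub_mem (add_mem (add_mem
      (add_mem (sub_mem (add_mem (sub_mem (sub_mem
      (sub_mem (sub_mem h0 h1) h2) h3) h4) h5) h6) h7) h8) h9) h10) h11) h12) h13
  refine Eq.trans (congrArg _ <| funext fun w => ?_) h
  simp [quadraticPart, quarticPart, mul_add, add_mul, mul_sub, sub_mul, mul_assoc, hLR, hLR']
  abel

end CommutingFamilies

namespace Dialgebra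

variable {k D : Type*} [CommRing k] [AddCommGroup D] [Module k D] (A : Dialgebra k D)

/-- The operator `x ↦ b ⊢ x`. -/
def opL (b : D) : Module.End k D := A.r b

/-- The operator `x ↦ x ⊣ c`. -/
def opR (c : D) : Module.End k D := A.l.flip c

/-- The operator `a ↦ [a, b, c]`. -/
def patsOp (b c : D) : Module.End k D :=
  quadraticPart A.opL A.opR b c - quadraticPart A.opL A.opR c b

theorem opR_mul_opL (b c : D) : A.opR c * A.opL b = A.opL b * A.opR c := by
  ext x
  simp [opL, opR, A.inner_assoc]

theorem opL_l (b c : D) : A.opL (A.l b c) = A.opL b * A.opL c := by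
  ext x
  simp [opL, A.bar_right, A.r_assoc]

theorem opL_r (b c : D) : A.opL (A.r b c) = A.opL b * A.opL c := by
  ext x
  simp [opL, A.r_assoc]

theorem opR_l (b c : D) : A.opR (A.l b c) = A.opR c * A.opR b := by
  ext x
  simp [opR, A.l_assoc]

theorem opR_r (b c : D) : A.opR (A.r b c) = A.opR c * A.opR b := by
  ext x
  simp [opR, A.l_assoc, A.bar_left]

theorem pats_eq_patsOp (a b c : D) : A.pats a b c = A.patsOp b c a := by
  simp only [pats, patsOp, quadraticPart, opL, opR, LinearMap.sub_apply, Module.End.mul_apply,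
    LinearMap.flip_apply, A.inner_assoc]
  abel

theorem opL_add (b c : D) : A.opL (b + c) = A.opL b + A.opL c := map_add A.r b c

theorem opL_sub (b c : D) : A.opL (b - c) = A.opL b - A.opL c := map_sub A.r b c

theorem opR_add (b c : D) : A.opR (b + c) = A.opR b + A.opR c := map_add A.l.flip b c

theorem opR_sub (b c : D) : A.opR (b - c) = A.opR b - A.opR c := map_sub A.l.flip b c

theorem patsOp_pats (b c d e : D) :
    A.patsOp (A.pats b c d) e =
      quarticPart A.opL A.opR b c d e - quarticPart A.opL A.opR b d c e
        - quarticPart A.opL A.opR c b d e + quarticPart A.opL A.opR c d b e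
        + quarticPart A.opL A.opR d b c e - quarticPart A.opL A.opR d c b e := by
  simp only [patsOp, quadraticPart, quarticPart, pats, opL_add, opL_sub, opR_add, opR_sub,
    opL_l, opL_r, opR_l, opR_r, mul_add, add_mul, mul_sub, sub_mul, mul_assoc]
  abel

theorem alternate_patsOp_commutator_quarticPart (v : Fin 6 → D) :
    alternate v (fun w =>
      A.patsOp (w 4) (w 5) * quarticPart A.opL A.opR (w 0) (w 1) (w 2) (w 3)
        - quarticPart A.opL A.opR (w 0) (w 1) (w 2) (w 3) * A.patsOp (w 4) (w 5)) = 0 := by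
  let F : (Fin 6 → D) → Module.End k D := fun w =>
    quadraticPart A.opL A.opR (w 4) (w 5) * quarticPart A.opL A.opR (w 0) (w 1) (w 2) (w 3)
      - quarticPart A.opL A.opR (w 0) (w 1) (w 2) (w 3) * quadraticPart A.opL A.opR (w 4) (w 5)
  have hF : alternate v F = 0 := alternate_commutator_parts A.opR_mul_opL v
  have hsum : alternate v (F - fun w => F (w ∘ Equiv.swap 4 5)) = 0 := by
    rw [map_sub, alternate_comp_perm, hF, smul_zero, sub_zero]
  refine Eq.trans (congrArg _ <| funext fun w => ?_) hsum
  simp only [patsOp, F, Pi.sub_apply, Function.comp_apply, Equiv.swap_apply_left,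
    Equiv.swap_apply_right, mul_sub, sub_mul]
  have h0 : Equiv.swap (4 : Fin 6) 5 0 = 0 := by decide
  have h1 : Equiv.swap (4 : Fin 6) 5 1 = 1 := by decide
  have h2 : Equiv.swap (4 : Fin 6) 5 2 = 2 := by decide
  have h3 : Equiv.swap (4 : Fin 6) 5 3 = 3 := by decide
  rw [h0, h1, h2, h3]
  abel

theorem alternate_patsOp_commutator (v : Fin 6 → D) :
    alternate v (fun w =>
      A.patsOp (w 4) (w 5) * A.patsOp (A.pats (w 0) (w 1) (w 2)) (w 3)
        - A.patsOp (A.pats (w 0) (w 1) (w 2)) (w 3) * A.patsOp (w 4) (w 5)) = 0 := by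
  let F : (Fin 6 → D) → Module.End k D := fun w =>
    A.patsOp (w 4) (w 5) * quarticPart A.opL A.opR (w 0) (w 1) (w 2) (w 3)
      - quarticPart A.opL A.opR (w 0) (w 1) (w 2) (w 3) * A.patsOp (w 4) (w 5)
  have hF : alternate v F = 0 := A.alternate_patsOp_commutator_quarticPart v
  have h (π : Equiv.Perm (Fin 6)) : alternate v (fun w => F (w ∘ π)) = 0 := by
    rw [alternate_comp_perm, hF, smul_zero]
  have hsum : alternate v (F
      - (fun w => F (w ∘ (⟨![0, 2, 1, 3, 4, 5], ![0, 2, 1, 3, 4, 5], by decide, by decide⟩ :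
        Equiv.Perm (Fin 6))))
      - (fun w => F (w ∘ (⟨![1, 0, 2, 3, 4, 5], ![1, 0, 2, 3, 4, 5], by decide, by decide⟩ :
        Equiv.Perm (Fin 6))))
      + (fun w => F (w ∘ (⟨![1, 2, 0, 3, 4, 5], ![2, 0, 1, 3, 4, 5], by decide, by decide⟩ :
        Equiv.Perm (Fin 6))))
      + (fun w => F (w ∘ (⟨![2, 0, 1, 3, 4, 5], ![1, 2, 0, 3, 4, 5], by decide, by decide⟩ :
        Equiv.Perm (Fin 6))))
      - (fun w => F (w ∘ (⟨![2, 1, 0, 3, 4, 5], ![2, 1, 0, 3, 4, 5], by decide, by decide⟩ :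
        Equiv.Perm (Fin 6))))) = 0 := by
    simp only [map_add, map_sub, h, hF, add_zero, sub_zero]
  refine Eq.trans (congrArg _ <| funext fun w => ?_) hsum
  simp only [patsOp_pats, F, Pi.add_apply, Pi.sub_apply, Function.comp_apply,
    Equiv.coe_fn_mk, Matrix.cons_val, mul_add, add_mul, mul_sub, sub_mul]
  abel

end Dialgebra

/-- the PATS satisfies the degree-7 identity `12·R = 0`:
`Σ_{σ∈S₆} ε(σ) [[a,[bσ,cσ,dσ],eσ],fσ,gσ] − Σ_{σ∈S₆} ε(σ) [[a,bσ,cσ],[dσ,eσ,fσ],gσ] = 0`,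
where `σ` permutes the six letters `b,…,g` (here `v 0,…,v 5`). -/
theorem pats_identity_R
    (k D : Type*) [CommRing k] [AddCommGroup D] [Module k D]
    (A : Dialgebra k D) (a : D) (v : Fin 6 → D) :
    (∑ σ : Equiv.Perm (Fin 6), (Equiv.Perm.sign σ : ℤ) •
        A.pats (A.pats a (A.pats (v (σ 0)) (v (σ 1)) (v (σ 2))) (v (σ 3))) (v (σ 4)) (v (σ 5)))
    - (∑ σ : Equiv.Perm (Fin 6), (Equiv.Perm.sign σ : ℤ) •
        A.pats (A.pats a (v (σ 0)) (v (σ 1))) (A.pats (v (σ 2)) (v (σ 3)) (v (σ 4))) (v (σ 5)))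
    = 0 := by
  let F : (Fin 6 → D) → Module.End k D := fun w =>
    A.patsOp (w 4) (w 5) * A.patsOp (A.pats (w 0) (w 1) (w 2)) (w 3)
  let G : (Fin 6 → D) → Module.End k D := fun w =>
    A.patsOp (A.pats (w 0) (w 1) (w 2)) (w 3) * A.patsOp (w 4) (w 5)
  have hsub : alternate v (F - G) = 0 := A.alternate_patsOp_commutator v
  let π : Equiv.Perm (Fin 6) :=
    ⟨![2, 3, 4, 5, 0, 1], ![4, 5, 0, 1, 2, 3], by decide, by decide⟩
  have hrot : alternate v (fun w => A.patsOp (A.pats (w 2) (w 3) (w 4)) (w 5) *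
      A.patsOp (w 0) (w 1)) = alternate v G := by
    refine (alternate_comp_perm v G π).trans ?_
    have hsign : Equiv.Perm.sign π = 1 := by decide
    rw [hsign, Units.val_one, one_smul]
  rw [map_sub, ← hrot] at hsub
  have ha := congrArg (fun φ : Module.End k D => φ a) hsub
  simpa only [alternate_apply, F, Dialgebra.pats_eq_patsOp, LinearMap.sub_apply,
    LinearMap.sum_apply, LinearMap.smul_apply, Module.End.mul_apply, LinearMap.zero_apply,
    Function.comp_apply] using ha
end
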